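/- Let X be a finite set with |X| = n ≥ 1. The number of choice functions C : 2^X → 2^X (with C(S) ⊆ S for all S) that are simultaneously substitutable, consistent, and cardinal monotone is at least 2^{binom(n-1, ⌊(n-1)/2⌋)}. -/

import Mathlib

/-- The choice function that rejects only the element `a`, and does so exactly when the
other available elements form a member of the family `U`. -/
def rejectOn {X : Type*} [DecidableEq X] (a : X) (U : Set (Finset X)) [DecidablePred (· ∈ U)]
    (S : Finset X) : Finset X :=
  if S.erase a ∈ U then S.erase a else S

section rejectOn

variable {X : Type*} [DecidableEq X] (a : X) (U : Set (Finset X)) [DecidablePred (· ∈ U)]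

theorem rejectOn_subset (S : Finset X) : rejectOn a U S ⊆ S := by
  unfold rejectOn
  split_ifs
  · exact Finset.erase_subset _ _
  · exact subset_rfl

theorem mem_rejectOn {b : X} {S : Finset X} :
    b ∈ rejectOn a U S ↔ b ∈ S ∧ (b = a → S.erase a ∉ U) := by
  unfold rejectOn
  split_ifs with h <;> simp [h, and_comm]

theorem rejectOn_substitutable (hU : IsUpperSet U) {S T : Finset X} {b : X}
    (hb : b ∈ rejectOn a U S) (hTS : T ⊆ S) : b ∈ rejectOn a U (insert b T) := by
  rw [mem_rejectOn] at hb ⊢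
  refine ⟨Finset.mem_insert_self _ _, fun hba hmem => hb.2 hba (hU ?_ hmem)⟩
  exact Finset.erase_subset_erase _ (Finset.insert_subset hb.1 hTS)

theorem rejectOn_consistent {S T : Finset X} (hST : rejectOn a U S ⊆ T) (hTS : T ⊆ S) :
    rejectOn a U S = rejectOn a U T := by
  by_cases h : S.erase a ∈ U
  · have hS : S.erase a ⊆ T := by simpa [rejectOn, h] using hST
    have hT : T.erase a = S.erase a :=
      (Finset.erase_subset_erase _ hTS).antisymm
        (Finset.subset_erase.2 ⟨hS, Finset.notMem_erase _ _⟩)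
    simp [rejectOn, h, hT]
  · rw [hTS.antisymm (by simpa [rejectOn, h] using hST)]

theorem card_rejectOn_le_of_subset {S T : Finset X} (hST : S ⊆ T) :
    (rejectOn a U S).card ≤ (rejectOn a U T).card := by
  by_cases hT : T.erase a ∈ U
  · rcases hST.eq_or_ssubset with rfl | hlt
    · rfl
    · calc (rejectOn a U S).card ≤ S.card := Finset.card_le_card (rejectOn_subset a U S)
        _ ≤ T.card - 1 := Nat.le_sub_one_of_lt (Finset.card_lt_card hlt)
        _ ≤ (T.erase a).card := Finset.pred_card_le_card_erase
        _ = (rejectOn a U T).card := by simp [rejectOn, hT]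
  · calc (rejectOn a U S).card ≤ S.card := Finset.card_le_card (rejectOn_subset a U S)
      _ ≤ T.card := Finset.card_le_card hST
      _ = (rejectOn a U T).card := by simp [rejectOn, hT]

end rejectOn

theorem isUpperSet_mem_or_lt_card {X : Type*} {k : ℕ} {F : Finset (Finset X)}
    (hF : ∀ A ∈ F, A.card = k) : IsUpperSet {A : Finset X | A ∈ F ∨ k < A.card} := by
  rintro A B hAB (hA | hA)
  · rcases (show A ⊆ B from hAB).eq_or_ssubset with rfl | hlt
    · exact Or.inl hA
    · exact Or.inr (hF A hA ▸ Finset.card_lt_card hlt)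
  · exact Or.inr (hA.trans_le (Finset.card_le_card hAB))

/-- Let `X` be a finite set with `|X| = n ≥ 1`. The number of choice
functions `C : 2^X → 2^X` (with `C S ⊆ S`) that are simultaneously substitutable,
consistent, and cardinal monotone is at least `2 ^ (binomial (n-1) ⌊(n-1)/2⌋)`. -/
theorem stmt_19 {X : Type*} [Fintype X] [DecidableEq X] (n : ℕ)
    (hn : Fintype.card X = n) (hn1 : 1 ≤ n) :
    2 ^ (Nat.choose (n - 1) ((n - 1) / 2)) ≤
      Fintype.card {C : Finset X → Finset X //
        (∀ S, C S ⊆ S) ∧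
        (∀ S T b, b ∈ C S → T ⊆ S → b ∈ C (insert b T)) ∧
        (∀ S T, C S ⊆ T → T ⊆ S → C S = C T) ∧
        (∀ S T, S ⊆ T → (C S).card ≤ (C T).card)} := by
  classical
  obtain ⟨a⟩ : Nonempty X := Fintype.card_pos_iff.1 (by omega)
  set k := (n - 1) / 2
  let P := Finset.powersetCard k (Finset.univ.erase a)
  have hP : P.powerset.card = 2 ^ Nat.choose (n - 1) k := by
    simp [P, Finset.card_powerset, Finset.card_powersetCard, hn]
  have hcard {F : Finset (Finset X)} (hF : F ∈ P.powerset) : ∀ A ∈ F, A.card = k :=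
    fun A hA => (Finset.mem_powersetCard.1 (Finset.mem_powerset.1 hF hA)).2
  rw [← hP, ← Fintype.card_coe]
  refine Fintype.card_le_of_injective
    (fun F => ⟨rejectOn a {A | A ∈ F.1 ∨ k < A.card}, rejectOn_subset a _,
      fun _ _ _ => rejectOn_substitutable a _ (isUpperSet_mem_or_lt_card (hcard F.2)),
      fun _ _ => rejectOn_consistent a _, fun _ _ => card_rejectOn_le_of_subset a _⟩) ?_
  rintro ⟨F, hF⟩ ⟨G, hG⟩ hFG
  have hfun := congrArg Subtype.val hFG
  have key (A : Finset X) (hA : A ∈ P) : A ∈ F ↔ A ∈ G := by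
    obtain ⟨hAa, hAk⟩ := Finset.mem_powersetCard.1 hA
    have haA : a ∉ A := fun h => Finset.notMem_erase _ _ (hAa h)
    have h := congrArg (a ∈ ·) (congrFun hfun (insert a A))
    simpa [mem_rejectOn, Finset.erase_insert haA, hAk, not_iff_not] using h
  refine Subtype.ext (Finset.ext fun A => ⟨fun h => ?_, fun h => ?_⟩)
  · exact (key A (Finset.mem_powerset.1 hF h)).1 h
  · exact (key A (Finset.mem_powerset.1 hG h)).2 h
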